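/- From the position P5, placing a chap at g8 is Betty's unique non-losing move: after Betty places a chap at g8, Alfred has no winning strategy from the resulting position, while after every other legal move of Betty from P5, Alfred has a winning strategy from the resulting position. -/

import Mathlib

/-!
Formalization of Philosophers' Phutball on an `m × n` board (`m` rows, `n` columns).
Points are pairs `(column, row)` of integers, with columns `1, …, n` (a, b, c, …)
and rows `1, …, m` (bottom to top).  Player `true` is Alfred (first player, aims
for the top row `m`); player `false` is Betty (aims for the bottom row `1`).
-/

/-- A player: `true` is Alfred, `false` is Betty. -/
abbrev Player := Bool

/-- A Phutball position: the ball's point `(column, row)`, the finite set of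
chaps, and the player whose turn it is. -/
structure PState where
  ball : ℤ × ℤ
  chaps : Finset (ℤ × ℤ)
  turn : Player
deriving DecidableEq

/-- The eight horizontal, vertical and diagonal directions. -/
def dirs : Finset (ℤ × ℤ) :=
  {(1, 0), (1, 1), (0, 1), (-1, 1), (-1, 0), (-1, -1), (0, -1), (1, -1)}

/-- The point reached from `b` after `i` steps in direction `d`. -/
def ray (b d : ℤ × ℤ) (i : ℤ) : ℤ × ℤ := (b.1 + i * d.1, b.2 + i * d.2)

/-- A point is on the `m × n` board. -/
def OnBoard (m n : ℤ) (p : ℤ × ℤ) : Prop :=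
  1 ≤ p.1 ∧ p.1 ≤ n ∧ 1 ≤ p.2 ∧ p.2 ≤ m

/-- A single hop on a board with `n` columns: the ball at `b` moves in one of the
eight directions `d` over a contiguous nonempty line of `k` chaps, landing on the
first point beyond them that carries no chap; the jumped-over chaps are removed.
The landing point must not lie onto or past the sidelines (outside columns
`1, …, n`), but it may lie past the top or bottom row. -/
def Hop (n : ℤ) (b : ℤ × ℤ) (c : Finset (ℤ × ℤ)) (b' : ℤ × ℤ) (c' : Finset (ℤ × ℤ)) : Prop :=
  ∃ d ∈ dirs, ∃ k : ℕ, 1 ≤ k ∧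
    (∀ i : ℕ, 1 ≤ i → i ≤ k → ray b d i ∈ c) ∧
    ray b d (k + 1) ∉ c ∧
    1 ≤ (ray b d (k + 1)).1 ∧ (ray b d (k + 1)).1 ≤ n ∧
    b' = ray b d (k + 1) ∧
    c' = c \ Finset.image (fun i : ℕ => ray b d i) (Finset.Icc 1 k)

/-- A jump is a nonempty sequence of hops (the player may stop after any hop,
and the removed chaps cannot be re-used by later hops of the same jump).  The
jump can continue after a hop only if the ball has not been carried past the top
or bottom row (which would end the game immediately). -/
inductive Jump (m n : ℤ) : ℤ × ℤ → Finset (ℤ × ℤ) → ℤ × ℤ → Finset (ℤ × ℤ) → Prop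
  | single {b c b' c'} : Hop n b c b' c' → Jump m n b c b' c'
  | cons {b c b₁ c₁ b' c'} : Hop n b c b₁ c₁ → 1 ≤ b₁.2 → b₁.2 ≤ m →
      Jump m n b₁ c₁ b' c' → Jump m n b c b' c'

/-- The winner, if any, of a position (evaluated between turns): Alfred wins if
the ball rests on the top row `m` or has been carried past it; Betty wins if the
ball rests on the bottom row `1` or has been carried past it. -/
def winner (m : ℤ) (s : PState) : Option Player :=
  if m ≤ s.ball.2 then some true else if s.ball.2 ≤ 1 then some false else none

/-- A single legal move on the `m × n` board: the player to move either places a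
chap on a vacant on-board point, or moves the ball by a jump; the turn passes to
the other player. -/
def MoveRel (m n : ℤ) (s t : PState) : Prop :=
  t.turn = !s.turn ∧
    ((∃ p, OnBoard m n p ∧ p ∉ s.chaps ∧ p ≠ s.ball ∧
        t.ball = s.ball ∧ t.chaps = insert p s.chaps) ∨
      Jump m n s.ball s.chaps t.ball t.chaps)

/-- An infinite record of play: while the game is not over and a legal move
exists, a legal move is made; otherwise the position is frozen forever. -/
def IsPlay (m n : ℤ) (f : ℕ → PState) : Prop :=
  ∀ k,
    (winner m (f k) = none ∧ (∃ t, MoveRel m n (f k) t) ∧ MoveRel m n (f k) (f (k + 1))) ∨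
    ((winner m (f k) ≠ none ∨ ¬ ∃ t, MoveRel m n (f k) t) ∧ f (k + 1) = f k)

/-- A strategy for player `p` that always proposes a legal move whenever the game
is not over, it is `p`'s turn, and some legal move exists. -/
def LegalStrategy (m n : ℤ) (p : Player) (σ : PState → PState) : Prop :=
  ∀ s, s.turn = p → winner m s = none → (∃ t, MoveRel m n s t) → MoveRel m n s (σ s)

/-- The play `f` follows the strategy `σ` of player `p`. -/
def Follows (m n : ℤ) (p : Player) (σ : PState → PState) (f : ℕ → PState) : Prop :=
  ∀ k, (f k).turn = p → winner m (f k) = none → (∃ t, MoveRel m n (f k) t) →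
    f (k + 1) = σ (f k)

/-- Player `p` has a winning strategy from `s₀` on the `m × n` board: a legal
strategy guaranteeing that, against every play of the opponent, `p` wins after
finitely many moves. -/
def WinsFrom (m n : ℤ) (p : Player) (s₀ : PState) : Prop :=
  ∃ σ, LegalStrategy m n p σ ∧
    ∀ f, IsPlay m n f → f 0 = s₀ → Follows m n p σ f → ∃ k, winner m (f k) = some p

/-- Player `p` has a drawing strategy from `s₀` on the `m × n` board: a legal
strategy guaranteeing that the opponent never wins (play may continue forever). -/
def DrawsFrom (m n : ℤ) (p : Player) (s₀ : PState) : Prop :=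
  ∃ σ, LegalStrategy m n p σ ∧
    ∀ f, IsPlay m n f → f 0 = s₀ → Follows m n p σ f → ∀ k, winner m (f k) ≠ some (!p)

/-- A position is drawn if both players have drawing strategies from it. -/
def Drawn (m n : ℤ) (s : PState) : Prop :=
  DrawsFrom m n true s ∧ DrawsFrom m n false s

/-- The 24 chaps of the position `P0` on the 12 × 10 board:
c1, c2, c5, c7, c9, c10, c11, c12, d6, e4, e11, e12, f1, f2, f9, g7,
h1, h2, h3, h4, h6, h8, h11, h12. -/
def P0chaps : Finset (ℤ × ℤ) :=
  {(3, 1), (3, 2), (3, 5), (3, 7), (3, 9), (3, 10), (3, 11), (3, 12), (4, 6), (5, 4), (5, 11), (5, 12), (6, 1), (6, 2), (6, 9), (7, 7), (8, 1), (8, 2), (8, 3), (8, 4), (8, 6), (8, 8), (8, 11), (8, 12)}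

/-- The position `P0`: ball at a2 = (1, 2), the 24 chaps above, Alfred to move. -/
def P0 : PState := ⟨(1, 2), P0chaps, true⟩

/-- The position `P5`: `P0` with additional chaps at b3, c4, d5, e6, f7, with Betty to move. -/
def P5 : PState := ⟨(1, 2), P0chaps ∪ {(2, 3), (3, 4), (4, 5), (5, 6), (6, 7)}, false⟩

/-- The result of Betty placing a chap at g8 = (7, 8) from `P5`. -/
def P5_g8 : PState := ⟨(1, 2), insert (7, 8) P5.chaps, true⟩

/-! ### Winning in a bounded number of turns -/

section Strategy

variable {m n : ℤ} {p : Player} {G : PState → Prop}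

/-- Player `p` can force the play within `k` turns to a win or to a position in `G`. -/
def WinsIn (m n : ℤ) (p : Player) (G : PState → Prop) : ℕ → PState → Prop
  | 0, s => winner m s = some p ∨ G s
  | k + 1, s => WinsIn m n p G k s ∨ (winner m s = none ∧
      ((s.turn = p ∧ ∃ t, MoveRel m n s t ∧ WinsIn m n p G k t) ∨
        (s.turn = !p ∧ (∃ t, MoveRel m n s t) ∧ ∀ t, MoveRel m n s t → WinsIn m n p G k t)))

/-- The opponent of `p` has to move, and all moves lead to positions where `p` can force the play
within `k` turns to a win or to a position in `G`. -/
def Forces (m n : ℤ) (p : Player) (G : PState → Prop) (k : ℕ) (s : PState) : Prop :=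
  winner m s = none ∧ s.turn = (!p) ∧ (∃ t, MoveRel m n s t) ∧
    ∀ t, MoveRel m n s t → WinsIn m n p G k t

theorem WinsIn.mono {k l : ℕ} (h : k ≤ l) {s : PState} (hs : WinsIn m n p G k s) :
    WinsIn m n p G l s := by
  induction h with
  | refl => exact hs
  | step _ ih => exact Or.inl ih

theorem Forces.winsIn {k : ℕ} {s : PState} (h : Forces m n p G k s) :
    WinsIn m n p G (k + 1) s :=
  Or.inr ⟨h.1, Or.inr h.2⟩

theorem WinsIn.winsFrom {k : ℕ} {s : PState} (hs : WinsIn m n p (fun _ => False) k s) :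
    WinsFrom m n p s := by
  classical
  set W := WinsIn m n p (fun _ => False)
  let σ : PState → PState := fun s =>
    if h : ∃ t, MoveRel m n s t ∧ ∃ k, W k t ∧ ¬ W k s then h.choose
    else if h : ∃ t, MoveRel m n s t then h.choose else s
  refine ⟨σ, fun s _ _ h => ?_, fun f hf h0 hσ => ?_⟩
  · by_cases h' : ∃ t, MoveRel m n s t ∧ ∃ k, W k t ∧ ¬ W k s
    · simp only [σ, dif_pos h']
      exact h'.choose_spec.1
    · simp only [σ, dif_neg h', dif_pos h]
      exact h.choose_spec
  suffices ∀ k i, W k (f i) → ∃ j, winner m (f j) = some p from this k 0 (h0 ▸ hs)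
  intro k
  induction k with
  | zero => rintro i (h | h); exacts [⟨i, h⟩, h.elim]
  | succ k ih =>
    intro i hi
    by_cases hk : W k (f i)
    · exact ih i hk
    rcases hi with h | ⟨hw, ⟨ht, t, hm, h⟩ | ⟨ht, ⟨t, hm⟩, h⟩⟩
    · exact ih i h
    · have h' : ∃ t, MoveRel m n (f i) t ∧ ∃ k, W k t ∧ ¬ W k (f i) := ⟨t, hm, k, h, hk⟩
      have e : f (i + 1) = h'.choose := by
        rw [hσ i ht hw ⟨t, hm⟩]
        simp only [σ, dif_pos h']
      obtain ⟨-, l, hl, hl'⟩ := h'.choose_spec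
      refine ih (i + 1) (WinsIn.mono (k := l) ?_ (e ▸ hl))
      by_contra! hlk
      exact hl' (WinsIn.mono (k := k + 1) hlk (Or.inr ⟨hw, Or.inl ⟨ht, t, hm, h⟩⟩))
    · rcases hf i with h' | ⟨h' | h', -⟩
      · exact ih (i + 1) (h _ h'.2.2)
      · exact absurd hw h'
      · exact absurd ⟨t, hm⟩ h'

/-- A player cannot win from a set of positions in which the opponent can keep the play. -/
theorem not_winsFrom_of_invariant (S : PState → Prop)
    (hw : ∀ s, S s → winner m s ≠ some p)
    (hp : ∀ s, S s → winner m s = none → s.turn = p → ∀ t, MoveRel m n s t → S t)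
    (ho : ∀ s, S s → winner m s = none → s.turn ≠ p → (∃ t, MoveRel m n s t) →
      ∃ t, MoveRel m n s t ∧ S t)
    {s₀ : PState} (h₀ : S s₀) : ¬ WinsFrom m n p s₀ := by
  classical
  rintro ⟨σ, hσ, h⟩
  let g : PState → PState := fun s =>
    if winner m s = none ∧ ∃ t, MoveRel m n s t then
      if s.turn = p then σ s
      else if h : ∃ t, MoveRel m n s t ∧ S t then h.choose else s
    else s
  have key : ∀ s, S s → S (g s) ∧ (winner m s = none ∧ (∃ t, MoveRel m n s t) →
      MoveRel m n s (g s)) := by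
    intro s hs
    by_cases h1 : winner m s = none ∧ ∃ t, MoveRel m n s t
    · by_cases h2 : s.turn = p
      · simp only [g, if_pos h1, if_pos h2]
        have := hσ s h2 h1.1 h1.2
        exact ⟨hp s hs h1.1 h2 _ this, fun _ => this⟩
      · have h3 := ho s hs h1.1 h2 h1.2
        simp only [g, if_pos h1, if_neg h2, dif_pos h3]
        exact ⟨h3.choose_spec.2, fun _ => h3.choose_spec.1⟩
    · simp only [g, if_neg h1]
      exact ⟨hs, fun h => absurd h h1⟩
  let f : ℕ → PState := fun k => g^[k] s₀
  have hf : ∀ k, f (k + 1) = g (f k) := fun k => Function.iterate_succ_apply' g k s₀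
  have hS : ∀ k, S (f k) := by
    intro k
    induction k with
    | zero => exact h₀
    | succ k ih => rw [hf]; exact (key _ ih).1
  have hplay : IsPlay m n f := by
    intro k
    rw [hf]
    by_cases h1 : winner m (f k) = none ∧ ∃ t, MoveRel m n (f k) t
    · exact Or.inl ⟨h1.1, h1.2, (key _ (hS k)).2 h1⟩
    · refine Or.inr ⟨by tauto, ?_⟩
      simp only [g, if_neg h1]
  have hfollows : Follows m n p σ f := by
    intro k h1 h2 h3
    rw [hf]
    simp only [g, if_pos (And.intro h2 h3), if_pos h1]
  obtain ⟨k, hk⟩ := h f hplay rfl hfollows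
  exact hw _ (hS k) hk

/-- A player cannot win from a position in which all moves let the opponent force a win or a
position in `G`, if the opponent can continue in this way from each position in `G`. -/
theorem Forces.not_winsFrom
    (hG : ∀ s, G s → winner m s = none ∧ s.turn = p ∧
      ∃ t, MoveRel m n s t ∧ (winner m t = some p ∨ ∃ k, Forces m n p G k t))
    {k : ℕ} {s : PState} (hs : Forces m n p G k s) : ¬ WinsFrom m n (!p) s := by
  refine not_winsFrom_of_invariant (fun s => ∃ k, WinsIn m n p G k s) ?_ ?_ ?_ ⟨_, hs.winsIn⟩
  all_goals rintro s ⟨k, hk⟩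
  · induction k with
    | zero =>
      rcases hk with h | h
      · simp [h]
      · simp [(hG s h).1]
    | succ k ih =>
      rcases hk with h | ⟨h, -⟩
      · exact ih h
      · simp [h]
  · intro hw ht t hm
    induction k with
    | zero =>
      rcases hk with h | h
      · simp [h] at hw
      · simp [(hG s h).2.1] at ht
    | succ k ih =>
      rcases hk with h | ⟨-, ⟨h, -⟩ | ⟨-, -, h⟩⟩
      · exact ih h
      · simp [h] at ht
      · exact ⟨k, h t hm⟩
  · intro hw ht hm
    induction k with
    | zero =>
      rcases hk with h | h
      · simp [h] at hw
      · obtain ⟨-, -, t, hm, h⟩ := hG s h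
        rcases h with h | ⟨k, h⟩
        · exact ⟨t, hm, 0, Or.inl h⟩
        · exact ⟨t, hm, _, h.winsIn⟩
    | succ k ih =>
      rcases hk with h | ⟨-, ⟨-, t, hm, h⟩ | ⟨h, -⟩⟩
      · exact ih h
      · exact ⟨t, hm, k, h⟩
      · exact absurd h ht

end Strategy

/-! ### Hops as sequences of single steps -/

/-- The part of a hop in direction `d` that starts with the ball over the point `q`. -/
inductive Slide (n : ℤ) (d : ℤ × ℤ) :
    ℤ × ℤ → Finset (ℤ × ℤ) → ℤ × ℤ → Finset (ℤ × ℤ) → Prop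
  | land {q c} : q ∉ c → 1 ≤ q.1 → q.1 ≤ n → Slide n d q c q c
  | next {q c q' c'} : q ∈ c → Slide n d (q + d) (c.erase q) q' c' → Slide n d q c q' c'

theorem ray_succ (q d : ℤ × ℤ) (i : ℤ) : ray q d (i + 1) = ray (q + d) d i := by
  simp only [ray, Prod.fst_add, Prod.snd_add, Prod.mk.injEq]
  constructor <;> ring

theorem ray_zero (q d : ℤ × ℤ) : ray q d 0 = q := by simp [ray]

theorem ne_ray {d : ℤ × ℤ} (hd : d ≠ 0) (q : ℤ × ℤ) {i : ℤ} (hi : i ≠ 0) : ray q d i ≠ q := by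
  intro h
  apply hd
  simp only [ray, Prod.ext_iff, add_eq_left, mul_eq_zero, hi, false_or] at h
  exact Prod.ext h.1 h.2

theorem image_ray_succ (q d : ℤ × ℤ) (k : ℕ) :
    (Finset.range (k + 1)).image (fun i : ℕ => ray q d i) =
      insert q ((Finset.range k).image fun i : ℕ => ray (q + d) d i) := by
  ext x
  simp only [Finset.mem_image, Finset.mem_range, Finset.mem_insert]
  constructor
  · rintro ⟨_ | i, hi, rfl⟩
    · exact Or.inl (ray_zero q d)
    · exact Or.inr ⟨i, by omega, by push_cast; rw [ray_succ]⟩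
  · rintro (rfl | ⟨i, hi, rfl⟩)
    · exact ⟨0, by omega, ray_zero x d⟩
    · exact ⟨i + 1, by omega, by push_cast; rw [ray_succ]⟩

theorem slide_iff {n : ℤ} {d : ℤ × ℤ} (hd : d ≠ 0) {q : ℤ × ℤ} {c : Finset (ℤ × ℤ)}
    {q' : ℤ × ℤ} {c' : Finset (ℤ × ℤ)} :
    Slide n d q c q' c' ↔ ∃ k : ℕ, (∀ i < k, ray q d i ∈ c) ∧ ray q d k ∉ c ∧
      1 ≤ (ray q d k).1 ∧ (ray q d k).1 ≤ n ∧ q' = ray q d k ∧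
      c' = c \ (Finset.range k).image fun i : ℕ => ray q d i := by
  have hr : ∀ (q : ℤ × ℤ) (i : ℕ), ray (q + d) d i ≠ q := fun q i => by
    rw [← ray_succ]
    exact ne_ray hd q (by omega)
  constructor
  · intro h
    induction h with
    | @land q c h1 h2 h3 => exact ⟨0, by simp, by simpa [ray_zero] using ⟨h1, h2, h3⟩⟩
    | @next q c q' c' hq _ ih =>
      obtain ⟨k, h1, h2, h3, h4, h5, h6⟩ := ih
      have e : ray q d ((k + 1 : ℕ) : ℤ) = ray (q + d) d k := by push_cast; rw [ray_succ]
      refine ⟨k + 1, ?_, ?_, by rwa [e], by rwa [e], by rwa [e], ?_⟩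
      · rintro (_ | i) hi
        · simpa [ray_zero] using hq
        · push_cast
          rw [ray_succ]
          exact Finset.mem_of_mem_erase (h1 i (by omega))
      · rw [e]
        exact fun h => h2 (Finset.mem_erase.2 ⟨hr q k, h⟩)
      · rw [h6, image_ray_succ, Finset.erase_eq, sdiff_sdiff_left]
        rfl
  · rintro ⟨k, h1, h2, h3, h4, rfl, rfl⟩
    induction k generalizing q c with
    | zero =>
      simp only [Nat.cast_zero, ray_zero] at h2 h3 h4
      simpa [ray_zero] using Slide.land (d := d) h2 h3 h4
    | succ k ih =>
      have hq : q ∈ c := by simpa [ray_zero] using h1 0 (by omega)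
      push_cast at h2 h3 h4 ⊢
      rw [ray_succ] at h2 h3 h4 ⊢
      refine Slide.next hq ?_
      have := @ih (q + d) (c.erase q) (fun i hi => ?_) (fun h => h2 (Finset.mem_of_mem_erase h))
        h3 h4
      · rw [image_ray_succ]
        convert this using 1
        rw [Finset.erase_eq, sdiff_sdiff_left]
        rfl
      · refine Finset.mem_erase.2 ⟨hr q i, ?_⟩
        rw [← ray_succ]
        exact_mod_cast h1 (i + 1) (by omega)

theorem hop_iff {n : ℤ} {b : ℤ × ℤ} {c : Finset (ℤ × ℤ)} {b' : ℤ × ℤ} {c' : Finset (ℤ × ℤ)} :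
    Hop n b c b' c' ↔ ∃ d ∈ dirs, b + d ∈ c ∧ Slide n d (b + d) c b' c' := by
  refine exists_congr fun d => and_congr_right fun hd => ?_
  have hd0 : d ≠ 0 := by rintro rfl; revert hd; decide
  have e : ∀ k : ℕ, (Finset.Icc 1 k).image (fun i : ℕ => ray b d i) =
      (Finset.range k).image fun i : ℕ => ray (b + d) d i := by
    intro k
    ext x
    simp only [Finset.mem_image, Finset.mem_Icc, Finset.mem_range]
    constructor
    · rintro ⟨i, hi, rfl⟩
      refine ⟨i - 1, by omega, ?_⟩
      rw [← ray_succ]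
      congr 1
      omega
    · rintro ⟨i, hi, rfl⟩
      exact ⟨i + 1, by omega, by push_cast; rw [ray_succ]⟩
  rw [slide_iff hd0]
  constructor
  · rintro ⟨k, hk, h1, h⟩
    simp only [ray_succ, e] at h
    have h1' : ∀ i < k, ray (b + d) d i ∈ c := fun i hi => by
      rw [← ray_succ]
      exact_mod_cast h1 (i + 1) (by omega) (by omega)
    exact ⟨by simpa [ray_zero] using h1' 0 (by omega), k, h1', h⟩
  · rintro ⟨h0, k, h1, h⟩
    refine ⟨k, ?_, fun i hi hi' => ?_, ?_⟩
    · rcases k with _ | k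
      · simp [ray_zero, h0] at h
      · omega
    · obtain ⟨i, rfl⟩ : ∃ j, i = j + 1 := ⟨i - 1, by omega⟩
      push_cast
      rw [ray_succ]
      exact h1 i (by omega)
    · simpa only [ray_succ, e] using h

/-! ### Bitmaps of the 12 × 10 board

The point `(x, y)` has index `12 * y + x`, so that a step in a fixed direction changes the index
by a constant; a natural number is read as the set of the indices of its nonzero bits. -/

/-- The point with index `i`. -/
def pt (i : ℕ) : ℤ × ℤ := ((i % 12 : ℕ), (i / 12 : ℕ))

/-- The bitmap of all points of the board. -/
def full : ℕ := 45638466880021785266250597798191621767644045312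

/-- Remove an index from a bitmap. -/
def clr (B i : ℕ) : ℕ := B ^^^ (B &&& 2 ^ i)

/-- The eight directions, numbered counterclockwise. -/
def dir : ℕ → ℤ × ℤ
  | 0 => (1, 0)
  | 1 => (1, 1)
  | 2 => (0, 1)
  | 3 => (-1, 1)
  | 4 => (-1, 0)
  | 5 => (-1, -1)
  | 6 => (0, -1)
  | _ => (1, -1)

/-- The index of the neighbour in direction `d`. -/
def step (d i : ℕ) : ℕ :=
  match d with
  | 0 => i + 1
  | 1 => i + 13
  | 2 => i + 12
  | 3 => i + 11
  | 4 => i - 1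
  | 5 => i - 13
  | 6 => i - 12
  | _ => i - 11

/-- The column of the point with index `i` is on the board. -/
def colOK (i : ℕ) : Bool := Nat.ble 1 (i % 12) && Nat.ble (i % 12) 10

/-- A ball at the point with index `i` is on the board, away from both goallines. -/
def inside (i : ℕ) : Bool := colOK i && Nat.ble 2 (i / 12) && Nat.ble (i / 12) 11

/-- A ball at the point with index `i` has won the game for player `p`. -/
def goal (p : Player) (i : ℕ) : Bool :=
  match p with
  | true => Nat.ble 12 (i / 12)
  | false => Nat.ble (i / 12) 1

/-- The row of the point with index `i` is on the board. -/
def rowOK (i : ℕ) : Bool := Nat.ble 1 (i / 12) && Nat.ble (i / 12) 12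

/-! ### Scripts of forcing play

A partially known set of chaps is described by two bitmaps `C`, `U`: every point of `C` carries a
chap, and every chap lies in `C ∪ U`. -/

/-- A script of forcing play for an attacker.  The first four constructors tell the attacker what
to do, the last four list answers to the moves of the defender. -/
inductive Script
  /-- win by a jump along the given directions -/
  | leaf (path : List ℕ)
  /-- a position of the given list is reached -/
  | cyc
  /-- place a chap -/
  | place (i : ℕ) (r : Script)
  /-- jump along the given directions -/
  | move (path : List ℕ) (r : Script)
  | nil
  /-- an answer to a chap at any point that is not excluded -/
  | fam (excluded : List ℕ) (s r : Script)
  /-- an answer to a chap at the given point -/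
  | pt (i : ℕ) (s r : Script)
  /-- an answer to some jumps -/
  | jmp (s r : Script)

/-- Three readings of a script: as an instruction to the attacker, as a list of answers all of
which must work after a placement, as a list of answers one of which must work after a jump. -/
inductive Mode
  | attack
  | placed
  | jumped

/-- The part of a hop of the attacker that starts with the ball over the point `i`. -/
def slide (d : ℕ) : ℕ → ℕ → ℕ → ℕ → Option (ℕ × ℕ × ℕ)
  | 0, _, _, _ => none
  | n + 1, i, C, U =>
    bif C.testBit i then slide d n (step d i) (clr C i) (clr U i)
    else bif !colOK i || U.testBit i then none else some (i, C, U)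

/-- A hop of the attacker. -/
def hop (d b C U : ℕ) : Option (ℕ × ℕ × ℕ) :=
  bif C.testBit (step d b) then slide d 13 (step d b) C U else none

/-- A jump of the attacker. -/
def run : List ℕ → ℕ → ℕ → ℕ → Option (ℕ × ℕ × ℕ)
  | [], _, _, _ => none
  | d :: l, b, C, U =>
    match hop d b C U with
    | none => none
    | some (b', C', U') =>
      match l with
      | [] => some (b', C', U')
      | _ :: _ => bif colOK b' && rowOK b' then run l b' C' U' else none

/-- All possible ends of a hop of the defender with the ball over the point `i` satisfy `F`. -/
def slideAll (d : ℕ) (F : ℕ → ℕ → ℕ → Bool) : ℕ → ℕ → ℕ → ℕ → Bool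
  | 0, _, _, _ => false
  | n + 1, i, C, U =>
    (C.testBit i || !colOK i || F i C (clr U i)) &&
      (!(C ||| U).testBit i || slideAll d F n (step d i) (clr C i) (clr U i))

/-- All possible ends of a hop of the defender satisfy `F`. -/
def hopAll (d : ℕ) (F : ℕ → ℕ → ℕ → Bool) (b C U : ℕ) : Bool :=
  !(C ||| U).testBit (step d b) ||
    slideAll d F 13 (step d (step d b)) (clr C (step d b)) (clr U (step d b))

/-- All possible ends of a jump of the defender satisfy `F`. -/
def runAll (F : ℕ → ℕ → ℕ → Bool) : ℕ → ℕ → ℕ → ℕ → Bool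
  | 0, _, _, _ => false
  | n + 1, b, C, U =>
    (List.range 8).all fun d =>
      hopAll d (fun i C U => F i C U && (!rowOK i || runAll F n i C U)) b C U

/-- The points of the board that are not excluded. -/
def coFinite (excluded : List ℕ) : ℕ := excluded.foldl clr full

/-- The points for which a list of answers has an answer to a placement. -/
def cover : Script → ℕ
  | .fam e _ r => coFinite e ||| cover r
  | .pt i _ r => 2 ^ i ||| cover r
  | .jmp _ r => cover r
  | _ => 0

/-- A list of answers handles all moves of the defender, except a placement in `E`. -/
def replies (p : Player) (E K : ℕ) (placed jumped : ℕ → ℕ → ℕ → Bool) (b C U : ℕ) : Bool :=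
  inside b && (full &&& (C ||| 2 ^ b ||| E ||| K)) == full &&
    !((full &&& (C ||| U ||| 2 ^ b)) == full) && placed b C U &&
    runAll (fun i C U => goal p i || (inside i && jumped i C U)) 40 b C U

/-- A script works for the attacker `p`, where reaching a position of the list `L` counts as a
success. -/
def valid (p : Player) (L : List (ℕ × ℕ)) : Script → Mode → ℕ → ℕ → ℕ → Bool
  | .leaf l, .attack, b, C, U =>
    match run l b C U with
    | none => false
    | some (i, _, _) => goal p i
  | .cyc, .attack, b, C, U => U == 0 && L.contains (b, C)
  | .place i r, .attack, b, C, U =>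
    colOK i && rowOK i && !(C ||| U ||| 2 ^ b).testBit i &&
      replies p 0 (cover r) (valid p L r .placed) (valid p L r .jumped) b (C ||| 2 ^ i) U
  | .move l r, .attack, b, C, U =>
    match run l b C U with
    | none => false
    | some (i, C', U') =>
      replies p 0 (cover r) (valid p L r .placed) (valid p L r .jumped) i C' U'
  | .nil, .placed, _, _, _ => true
  | .fam e s r, .placed, b, C, U =>
    valid p L s .attack b C (U ||| coFinite e) && valid p L r .placed b C U
  | .pt i s r, .placed, b, C, U =>
    valid p L s .attack b (C ||| 2 ^ i) (clr U i) && valid p L r .placed b C U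
  | .jmp _ r, .placed, b, C, U => valid p L r .placed b C U
  | .fam _ _ r, .jumped, b, C, U => valid p L r .jumped b C U
  | .pt _ _ r, .jumped, b, C, U => valid p L r .jumped b C U
  | .jmp s r, .jumped, b, C, U =>
    valid p L s .attack b C U || valid p L r .jumped b C U
  | _, _, _, _, _ => false

/-- A bound for the number of turns that a script takes after the first turn. -/
def depth : Script → ℕ
  | .place _ r | .move _ r => depth r
  | .fam _ s r | .pt _ s r | .jmp s r => max (depth s + 2) (depth r)
  | _ => 0

/-! ### Soundness of the bitmap computations -/

theorem pt_injective : Function.Injective pt := by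
  intro i j h
  simp only [pt, Prod.mk.injEq] at h
  omega

theorem dir_mem (d : ℕ) : dir d ∈ dirs := by
  rcases d with _ | _ | _ | _ | _ | _ | _ | d <;> simp [dir, dirs]

theorem exists_dir {d : ℤ × ℤ} (hd : d ∈ dirs) : ∃ k < 8, dir k = d := by
  revert d
  decide

theorem pt_step (d : ℕ) {i : ℕ} (h : OnBoard 12 10 (pt i)) : pt (step d i) = pt i + dir d := by
  simp only [OnBoard, pt] at h
  rcases d with _ | _ | _ | _ | _ | _ | _ | d <;>
    simp only [step, dir, pt, Prod.mk_add_mk, Prod.mk.injEq] <;> omega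

theorem colOK_iff {i : ℕ} : colOK i = true ↔ 1 ≤ (pt i).1 ∧ (pt i).1 ≤ 10 := by
  simp only [colOK, pt, Bool.and_eq_true, Nat.ble_eq]
  omega

theorem rowOK_iff {i : ℕ} : rowOK i = true ↔ 1 ≤ (pt i).2 ∧ (pt i).2 ≤ 12 := by
  simp only [rowOK, pt, Bool.and_eq_true, Nat.ble_eq]
  omega

theorem onBoard_pt {i : ℕ} : OnBoard 12 10 (pt i) ↔ colOK i = true ∧ rowOK i = true := by
  rw [colOK_iff, rowOK_iff, OnBoard]
  tauto

theorem exists_pt {q : ℤ × ℤ} (h : OnBoard 12 10 q) : ∃ i, pt i = q := by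
  obtain ⟨h1, h2, h3, h4⟩ := h
  refine ⟨(12 * q.2 + q.1).toNat, Prod.ext ?_ ?_⟩ <;> simp only [pt] <;> omega

theorem inside_iff {i : ℕ} :
    inside i = true ↔ (1 ≤ (pt i).1 ∧ (pt i).1 ≤ 10) ∧ 2 ≤ (pt i).2 ∧ (pt i).2 ≤ 11 := by
  rw [← colOK_iff]
  simp only [inside, Bool.and_eq_true, Nat.ble_eq, and_assoc]
  refine and_congr_right fun _ => ?_
  simp only [pt]
  omega

theorem onBoard_of_inside {i : ℕ} (h : inside i = true) : OnBoard 12 10 (pt i) := by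
  rw [inside_iff] at h
  simp only [OnBoard]
  omega

theorem winner_of_inside {i : ℕ} (h : inside i = true) (c : Finset (ℤ × ℤ)) (p : Player) :
    winner 12 ⟨pt i, c, p⟩ = none := by
  rw [inside_iff] at h
  simp only [winner]
  rw [if_neg (by omega), if_neg (by omega)]

theorem winner_of_goal {p : Player} {i : ℕ} (h : goal p i = true) (c : Finset (ℤ × ℤ))
    (q : Player) : winner 12 ⟨pt i, c, q⟩ = some p := by
  have hi : (pt i).2 = (i / 12 : ℕ) := rfl
  simp only [winner]
  cases p <;> simp only [goal, Nat.ble_eq] at h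
  · rw [if_neg (by omega), if_pos (by omega)]
  · rw [if_pos (by omega)]

theorem testBit_full (i : ℕ) : full.testBit i = true ↔ OnBoard 12 10 (pt i) := by
  rw [onBoard_pt, ← Bool.and_eq_true]
  by_cases hi : i < 168
  · revert i
    decide +kernel
  · rw [Nat.testBit_lt_two_pow (lt_of_lt_of_le (b := 2 ^ 168) (by decide) (Nat.pow_le_pow_right
      (by decide) (by omega)))]
    simp only [rowOK, Bool.and_eq_true, Nat.ble_eq, Bool.false_eq_true, false_iff]
    omega

theorem testBit_clr (B i j : ℕ) : (clr B i).testBit j = (B.testBit j && decide (j ≠ i)) := by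
  simp only [clr, Nat.testBit_xor, Nat.testBit_and, Nat.testBit_two_pow, eq_comm (a := i)]
  by_cases h : j = i <;> simp [h]

/-- The set `c` of chaps on the board satisfies `C ⊆ c ⊆ C ∪ U`. -/
def Known (C U : ℕ) (c : Finset (ℤ × ℤ)) : Prop :=
  (∀ i, C.testBit i = true → pt i ∈ c) ∧
    (∀ i, pt i ∈ c → C.testBit i = true ∨ U.testBit i = true) ∧ ∀ q ∈ c, OnBoard 12 10 q

namespace Known

variable {C U i : ℕ} {c : Finset (ℤ × ℤ)}

theorem erase (h : Known C U c) (i : ℕ) : Known (clr C i) (clr U i) (c.erase (pt i)) := by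
  simp only [Known, testBit_clr, Finset.mem_erase, pt_injective.ne_iff, Bool.and_eq_true,
    decide_eq_true_eq]
  refine ⟨fun j hj => ⟨hj.2, h.1 j hj.1⟩, fun j hj => ?_, fun q hq => h.2.2 q hq.2⟩
  have := h.2.1 j hj.2
  tauto

theorem clr_right (h : Known C U c) (hi : pt i ∉ c) : Known C (clr U i) c := by
  refine ⟨h.1, fun j hj => ?_, h.2.2⟩
  have hji : j ≠ i := by rintro rfl; exact hi hj
  simpa [testBit_clr, hji] using h.2.1 j hj

theorem weaken {V : ℕ} (h : Known C U c) : Known C (U ||| V) c :=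
  ⟨h.1, fun j hj => by rw [Nat.testBit_or, Bool.or_eq_true]; have := h.2.1 j hj; tauto, h.2.2⟩

theorem insert_right (h : Known C U c) (hi : OnBoard 12 10 (pt i)) (hU : U.testBit i = true) :
    Known C U (insert (pt i) c) := by
  simp only [Known, Finset.mem_insert, forall_eq_or_imp, pt_injective.eq_iff]
  exact ⟨fun j hj => Or.inr (h.1 j hj), ⟨Or.inr hU, h.2.1⟩, hi, h.2.2⟩

theorem insert_left (h : Known C U c) (hi : OnBoard 12 10 (pt i)) :
    Known (C ||| 2 ^ i) U (insert (pt i) c) := by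
  simp only [Known, Finset.mem_insert, forall_eq_or_imp, pt_injective.eq_iff, Nat.testBit_or,
    Nat.testBit_two_pow, Bool.or_eq_true, decide_eq_true_eq]
  refine ⟨?_, ⟨by simp, fun j hj => ?_⟩, hi, h.2.2⟩
  · rintro j (hj | rfl)
    · exact Or.inr (h.1 j hj)
    · exact Or.inl rfl
  · have := h.2.1 j hj
    tauto

theorem insert_clr (h : Known C U c) (hi : OnBoard 12 10 (pt i)) :
    Known (C ||| 2 ^ i) (clr U i) (insert (pt i) c) := by
  have h' := h.insert_left hi
  refine ⟨h'.1, fun j hj => ?_, h'.2.2⟩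
  have := h'.2.1 j hj
  simp only [testBit_clr, Nat.testBit_or, Nat.testBit_two_pow, Bool.or_eq_true, Bool.and_eq_true,
    decide_eq_true_eq] at this ⊢
  by_cases hj : j = i
  · exact Or.inl (Or.inr hj.symm)
  · tauto

end Known

section Moves

variable {d b C U b' C' U' : ℕ} {c : Finset (ℤ × ℤ)}

theorem exists_slide {n i : ℕ} (hs : slide d n i C U = some (b', C', U')) (h : Known C U c) :
    ∃ c', Slide 10 (dir d) (pt i) c (pt b') c' ∧ Known C' U' c' := by
  induction n generalizing i C U c with
  | zero => simp [slide] at hs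
  | succ n ih =>
    rw [slide] at hs
    cases hC : C.testBit i
    · rw [hC, cond_false] at hs
      cases hU : !colOK i || U.testBit i
      · rw [hU, cond_false] at hs
        simp only [Option.some.injEq, Prod.mk.injEq] at hs
        obtain ⟨rfl, rfl, rfl⟩ := hs
        simp only [Bool.or_eq_false_iff, Bool.not_eq_false'] at hU
        obtain ⟨h1, h2⟩ := colOK_iff.1 hU.1
        refine ⟨c, .land (fun hi => ?_) h1 h2, h⟩
        simpa [hC, hU.2] using h.2.1 i hi
      · simp [hU] at hs
    · rw [hC, cond_true] at hs
      have hi := h.1 i hC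
      obtain ⟨c', h1, h2⟩ := ih hs (h.erase i)
      rw [pt_step d (h.2.2 _ hi)] at h1
      exact ⟨c', .next hi h1, h2⟩

theorem exists_hop (hb : OnBoard 12 10 (pt b)) (hs : hop d b C U = some (b', C', U'))
    (h : Known C U c) : ∃ c', Hop 10 (pt b) c (pt b') c' ∧ Known C' U' c' := by
  rw [hop] at hs
  cases hC : C.testBit (step d b)
  · simp [hC] at hs
  · rw [hC, cond_true] at hs
    obtain ⟨c', h1, h2⟩ := exists_slide hs h
    have hm := h.1 _ hC
    rw [pt_step d hb] at h1 hm
    exact ⟨c', hop_iff.2 ⟨_, dir_mem d, hm, h1⟩, h2⟩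

theorem exists_jump {l : List ℕ} (hb : OnBoard 12 10 (pt b)) (hs : run l b C U = some (b', C', U'))
    (h : Known C U c) : ∃ c', Jump 12 10 (pt b) c (pt b') c' ∧ Known C' U' c' := by
  induction l generalizing b C U c with
  | nil => simp [run] at hs
  | cons d l ih =>
    rw [run] at hs
    split at hs
    · simp at hs
    · rename_i b₁ C₁ U₁ h₁
      obtain ⟨c₁, hc, hK⟩ := exists_hop hb h₁ h
      split at hs
      · simp only [Option.some.injEq, Prod.mk.injEq] at hs
        obtain ⟨rfl, rfl, rfl⟩ := hs
        exact ⟨c₁, .single hc, hK⟩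
      · cases hB : colOK b₁ && rowOK b₁
        · simp [hB] at hs
        · rw [hB, cond_true] at hs
          have hb₁ := onBoard_pt.2 (Bool.and_eq_true _ _ ▸ hB)
          obtain ⟨c', h1, h2⟩ := ih hb₁ hs hK
          exact ⟨c', .cons hc hb₁.2.2.1 hb₁.2.2.2 h1, h2⟩

variable {F : ℕ → ℕ → ℕ → Bool} {q' : ℤ × ℤ} {c' : Finset (ℤ × ℤ)}

theorem of_slideAll {n i : ℕ} (hs : slideAll d F n i C U = true) (h : Known C U c)
    (hq : Slide 10 (dir d) (pt i) c q' c') :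
    ∃ b' C' U', q' = pt b' ∧ Known C' U' c' ∧ F b' C' U' = true := by
  induction n generalizing i C U c with
  | zero => simp [slideAll] at hs
  | succ n ih =>
    simp only [slideAll, Bool.and_eq_true, Bool.or_eq_true, Bool.not_eq_true', Nat.testBit_or,
      Bool.or_eq_false_iff] at hs
    cases hq with
    | land h1 h2 h3 =>
      refine ⟨i, C, clr U i, rfl, h.clr_right h1, ?_⟩
      rcases hs.1 with (h' | h') | h'
      · exact absurd (h.1 i h') h1
      · simp [colOK_iff.2 ⟨h2, h3⟩] at h'
      · exact h'
    | next hi hq =>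
      rw [← pt_step d (h.2.2 _ hi)] at hq
      rcases hs.2 with h' | h'
      · simpa [h'] using h.2.1 i hi
      · exact ih h' (h.erase i) hq

theorem of_hopAll (hb : OnBoard 12 10 (pt b)) (hs : ∀ d < 8, hopAll d F b C U = true)
    (h : Known C U c) (hq : Hop 10 (pt b) c q' c') :
    ∃ b' C' U', q' = pt b' ∧ Known C' U' c' ∧ F b' C' U' = true := by
  obtain ⟨d, hd, hm, hq⟩ := hop_iff.1 hq
  obtain ⟨d, hd', rfl⟩ := exists_dir hd
  specialize hs d hd'
  simp only [hopAll, Bool.or_eq_true, Bool.not_eq_true', Nat.testBit_or,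
    Bool.or_eq_false_iff] at hs
  rw [← pt_step d hb] at hm hq
  rcases hs with h' | h'
  · simpa [h'] using h.2.1 _ hm
  · cases hq with
    | land h1 => exact absurd hm h1
    | next hi hq =>
      rw [← pt_step d (h.2.2 _ hi)] at hq
      exact of_slideAll h' (h.erase _) hq

theorem of_runAll {n : ℕ} (hb : OnBoard 12 10 (pt b)) (hs : runAll F n b C U = true)
    (h : Known C U c) (hq : Jump 12 10 (pt b) c q' c') :
    ∃ b' C' U', q' = pt b' ∧ Known C' U' c' ∧ F b' C' U' = true := by
  induction n generalizing b C U c with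
  | zero => simp [runAll] at hs
  | succ n ih =>
    simp only [runAll, List.all_eq_true, List.mem_range] at hs
    cases hq with
    | single hq =>
      obtain ⟨b', C', U', h1, h2, h3⟩ := of_hopAll hb hs h hq
      simp only [Bool.and_eq_true] at h3
      exact ⟨b', C', U', h1, h2, h3.1⟩
    | cons hq hr hr' hj =>
      obtain ⟨b₁, C₁, U₁, rfl, h2, h3⟩ := of_hopAll hb hs h hq
      have hB : OnBoard 12 10 (pt b₁) := by
        obtain ⟨d, -, k, -, -, -, hc, hc', he, -⟩ := hq
        rw [← he] at hc hc'
        exact ⟨hc, hc', hr, hr'⟩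
      simp only [Bool.and_eq_true, Bool.or_eq_true, (onBoard_pt.1 hB).2] at h3
      exact ih hB (by simpa using h3.2) h2 hj

end Moves

/-! ### Soundness of scripts -/

section Sound

variable {p : Player} {L : List (ℕ × ℕ)} {G : PState → Prop}

/-- The conclusions that a valid script permits in each of its readings. -/
def Meaning (p : Player) (G : PState → Prop) (s : Script) (b : ℕ)
    (c : Finset (ℤ × ℤ)) : Mode → Prop
  | .attack => (s = .cyc ∧ G ⟨pt b, c, p⟩) ∨
      ∃ t, MoveRel 12 10 ⟨pt b, c, p⟩ t ∧
        (winner 12 t = some p ∨ Forces 12 10 p G (depth s) t)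
  | .placed => ∀ i, (cover s).testBit i = true → OnBoard 12 10 (pt i) →
      WinsIn 12 10 p G (depth s) ⟨pt b, insert (pt i) c, p⟩
  | .jumped => WinsIn 12 10 p G (depth s) ⟨pt b, c, p⟩

theorem Meaning.winsIn {s : Script} {b : ℕ} {c : Finset (ℤ × ℤ)} (hb : inside b = true)
    (h : Meaning p G s b c .attack) : WinsIn 12 10 p G (depth s + 2) ⟨pt b, c, p⟩ := by
  rcases h with ⟨-, h⟩ | ⟨t, hm, h⟩
  · exact WinsIn.mono (Nat.zero_le _) (Or.inr h)
  · refine Or.inr ⟨winner_of_inside hb _ _, Or.inl ⟨rfl, t, hm, ?_⟩⟩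
    rcases h with h | h
    · exact WinsIn.mono (Nat.zero_le _) (Or.inl h)
    · exact h.winsIn

/-- Valid replies answer all moves of the defender but placements in `E`. -/
theorem of_replies {E b C U : ℕ} {r : Script} {c : Finset (ℤ × ℤ)} {F F' : ℕ → ℕ → ℕ → Bool}
    (hr : replies p E (cover r) F F' b C U = true) (h : Known C U c)
    (hF : F b C U = true → Meaning p G r b c .placed)
    (hF' : ∀ {b C U c}, inside b = true → Known C U c → F' b C U = true →
      Meaning p G r b c .jumped) :
    inside b = true ∧ (∃ t, MoveRel 12 10 ⟨pt b, c, !p⟩ t) ∧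
      ∀ t, MoveRel 12 10 ⟨pt b, c, !p⟩ t → WinsIn 12 10 p G (depth r) t ∨
        ∃ i, E.testBit i = true ∧ t = ⟨pt b, insert (pt i) c, p⟩ := by
  simp only [replies, Bool.and_eq_true, Bool.not_eq_true', beq_iff_eq] at hr
  obtain ⟨⟨⟨⟨hb, hK⟩, hU⟩, hP⟩, hJ⟩ := hr
  refine ⟨hb, ?_, ?_⟩
  · suffices ∃ i, OnBoard 12 10 (pt i) ∧ (C ||| U ||| 2 ^ b).testBit i = false by
      obtain ⟨i, hi, hi'⟩ := this
      simp only [Nat.testBit_or, Nat.testBit_two_pow, Bool.or_eq_false_iff,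
        decide_eq_false_iff_not] at hi'
      refine ⟨⟨pt b, insert (pt i) c, p⟩, by simp, Or.inl ⟨pt i, hi, fun hc => ?_, ?_, rfl, rfl⟩⟩
      · have := h.2.1 i hc
        simp [hi'] at this
      · exact fun e => hi'.2 (pt_injective e).symm
    by_contra! hn
    refine (beq_eq_false_iff_ne.1 hU) (Nat.eq_of_testBit_eq fun i => ?_)
    rw [Nat.testBit_and]
    cases hi : full.testBit i
    · rfl
    · exact Bool.eq_true_of_not_eq_false (hn i ((testBit_full i).1 hi))
  · rintro ⟨q, c', u⟩ ⟨ht, hm⟩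
    obtain rfl : u = p := by simpa using ht
    rcases hm with ⟨x, hx, hxc, hxb, hq, hc'⟩ | hj
    · obtain ⟨i, rfl⟩ := exists_pt hx
      simp only at hq hc' hxb hxc
      subst hq hc'
      have hi := congrArg (fun B : ℕ => B.testBit i) hK
      simp only [Nat.testBit_and, (testBit_full i).2 hx, Bool.true_and, Nat.testBit_or,
        Nat.testBit_two_pow, Bool.or_eq_true, decide_eq_true_eq] at hi
      rcases hi with ((hi | rfl) | hi) | hi
      · exact absurd (h.1 i hi) hxc
      · exact absurd rfl hxb
      · exact Or.inr ⟨i, hi, rfl⟩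
      · exact Or.inl (hF hP i hi hx)
    · obtain ⟨b', C', U', hq, h', hg⟩ := of_runAll (onBoard_of_inside hb) hJ h hj
      simp only at hq h'
      subst hq
      simp only [Bool.or_eq_true, Bool.and_eq_true] at hg
      rcases hg with hg | hg
      · exact Or.inl (WinsIn.mono (Nat.zero_le _) (Or.inl (winner_of_goal hg _ _)))
      · exact Or.inl (hF' hg.1 h' hg.2)

theorem forces_of_replies {b C U : ℕ} {r : Script} {c : Finset (ℤ × ℤ)}
    {F F' : ℕ → ℕ → ℕ → Bool}
    (hr : replies p 0 (cover r) F F' b C U = true) (h : Known C U c)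
    (hF : F b C U = true → Meaning p G r b c .placed)
    (hF' : ∀ {b C U c}, inside b = true → Known C U c → F' b C U = true →
      Meaning p G r b c .jumped) :
    Forces 12 10 p G (depth r) ⟨pt b, c, !p⟩ := by
  obtain ⟨hb, hm, ht⟩ := of_replies hr h hF hF'
  exact ⟨winner_of_inside hb _ _, rfl, hm, fun t hmt => by simpa using ht t hmt⟩

/-- A valid script does what it promises. -/
theorem meaning_of_valid
    (hG : ∀ {b C c}, (b, C) ∈ L → Known C 0 c → G ⟨pt b, c, p⟩) (s : Script) :
    ∀ (m : Mode) {b C U : ℕ} {c : Finset (ℤ × ℤ)}, inside b = true → Known C U c →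
      valid p L s m b C U = true → Meaning p G s b c m := by
  induction s with
  | leaf l =>
    rintro (_ | _ | _) b C U c hb h hv <;> simp only [valid, Bool.false_eq_true] at hv
    split at hv
    · simp at hv
    · rename_i b' C' U' hrun
      obtain ⟨c', hj, -⟩ := exists_jump (onBoard_of_inside hb) hrun h
      exact Or.inr ⟨⟨pt b', c', !p⟩, ⟨rfl, Or.inr hj⟩, Or.inl (winner_of_goal hv _ _)⟩
  | cyc =>
    rintro (_ | _ | _) b C U c hb h hv <;> simp only [valid, Bool.false_eq_true] at hv
    simp only [Bool.and_eq_true, beq_iff_eq, List.contains_iff_mem] at hv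
    obtain ⟨rfl, hv⟩ := hv
    exact Or.inl ⟨rfl, hG hv h⟩
  | place i r ih =>
    rintro (_ | _ | _) b C U c hb h hv <;> simp only [valid, Bool.false_eq_true] at hv
    simp only [Bool.and_eq_true, Bool.not_eq_true', Nat.testBit_or, Nat.testBit_two_pow,
      Bool.or_eq_false_iff, decide_eq_false_iff_not] at hv
    obtain ⟨⟨hi, hi'⟩, hv⟩ := hv
    have hi := onBoard_pt.2 hi
    refine Or.inr ⟨⟨pt b, insert (pt i) c, !p⟩,
      ⟨rfl, Or.inl ⟨pt i, hi, fun hc => ?_, ?_, rfl, rfl⟩⟩, Or.inr ?_⟩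
    · have := h.2.1 i hc
      simp [hi'] at this
    · exact fun e => hi'.2 (pt_injective e).symm
    · exact forces_of_replies (r := r) hv (h.insert_left hi) (ih _ hb (h.insert_left hi)) (ih _)
  | move l r ih =>
    rintro (_ | _ | _) b C U c hb h hv <;> simp only [valid, Bool.false_eq_true] at hv
    split at hv
    · simp at hv
    · rename_i b' C' U' hrun
      obtain ⟨c', hj, h'⟩ := exists_jump (onBoard_of_inside hb) hrun h
      have hb' : inside b' = true := by
        simp only [replies, Bool.and_eq_true] at hv
        exact hv.1.1.1.1
      exact Or.inr ⟨⟨pt b', c', !p⟩, ⟨rfl, Or.inr hj⟩,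
        Or.inr (forces_of_replies (r := r) hv h' (ih _ hb' h') (ih _))⟩
  | nil =>
    rintro (_ | _ | _) b C U c hb h hv <;> simp only [valid, Bool.false_eq_true] at hv
    simp [Meaning, cover]
  | fam e s r ihs ihr =>
    rintro (_ | _ | _) b C U c hb h hv <;> simp only [valid, Bool.false_eq_true] at hv
    · simp only [Bool.and_eq_true] at hv
      intro i hi hi'
      rw [cover, Nat.testBit_or, Bool.or_eq_true] at hi
      rcases hi with hi | hi
      · refine WinsIn.mono (le_max_left _ _) ((ihs .attack hb ?_ hv.1).winsIn hb)
        exact h.weaken.insert_right hi' (by simp [hi])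
      · exact WinsIn.mono (le_max_right _ _) (ihr .placed hb h hv.2 i hi hi')
    · exact WinsIn.mono (le_max_right _ _) (ihr .jumped hb h hv)
  | pt j s r ihs ihr =>
    rintro (_ | _ | _) b C U c hb h hv <;> simp only [valid, Bool.false_eq_true] at hv
    · simp only [Bool.and_eq_true] at hv
      intro i hi hi'
      rw [cover, Nat.testBit_or, Bool.or_eq_true, Nat.testBit_two_pow, decide_eq_true_eq] at hi
      rcases hi with rfl | hi
      · exact WinsIn.mono (le_max_left _ _) ((ihs .attack hb (h.insert_clr hi') hv.1).winsIn hb)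
      · exact WinsIn.mono (le_max_right _ _) (ihr .placed hb h hv.2 i hi hi')
    · exact WinsIn.mono (le_max_right _ _) (ihr .jumped hb h hv)
  | jmp s r ihs ihr =>
    rintro (_ | _ | _) b C U c hb h hv <;> simp only [valid, Bool.false_eq_true] at hv
    · intro i hi hi'
      exact WinsIn.mono (le_max_right _ _) (ihr .placed hb h hv i hi hi')
    · rw [Bool.or_eq_true] at hv
      rcases hv with hv | hv
      · exact WinsIn.mono (le_max_left _ _) ((ihs .attack hb h hv).winsIn hb)
      · exact WinsIn.mono (le_max_right _ _) (ihr .jumped hb h hv)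

end Sound

/-- The chaps of `P5` as a bitmap. -/
def bitsP5 : ℕ := 6602632166712011602879870760005035830438821888

/-- Answers for Alfred to every move of Betty from `P5`, except a chap at g8. -/
def repliesP5 : Script :=
  .fam [25, 103, 125] (.leaf [1, 3, 2]) <|
  .pt 125 (.leaf [1, 3, 1]) <|
  .jmp (.leaf [3, 2]) <|
  .jmp (.place 117 <|
      .fam [105, 129, 151] (.leaf [2, 3]) <|
      .pt 129 (.leaf [2, 3]) <|
      .pt 151 (.leaf [2, 3]) <|
      .jmp (.leaf [3]) <|
      .nil) <|
  .jmp (.leaf [2]) <|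
  .jmp (.place 90 <|
      .fam [79, 101, 127, 153] (.leaf [3, 1, 1]) <|
      .pt 101 (.leaf [3, 3, 1]) <|
      .pt 127 (.leaf [3, 1]) <|
      .pt 153 (.leaf [3, 1, 1]) <|
      .jmp (.place 80 <|
          .fam [79, 81, 101, 127, 153] (.leaf [4, 3, 1, 1]) <|
          .pt 79 (.leaf [4, 2, 2, 3]) <|
          .pt 101 (.leaf [4, 3, 3, 1]) <|
          .pt 127 (.leaf [4, 3, 1]) <|
          .pt 153 (.leaf [4, 3, 1, 1]) <|
          .jmp (.leaf [3, 1, 1]) <|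
          .jmp (.leaf [1, 1]) <|
          .jmp (.leaf [1]) <|
          .nil) <|
      .jmp (.leaf [1, 1]) <|
      .jmp (.leaf [1]) <|
      .nil) <|
  .jmp (.place 92 <|
      .fam [81, 103, 125] (.leaf [3, 3, 2]) <|
      .pt 103 (.leaf [3, 2]) <|
      .pt 125 (.leaf [3, 3, 1]) <|
      .jmp (.leaf [3, 2]) <|
      .jmp (.place 104 <|
          .fam [103, 105, 125] (.leaf [4, 3, 2]) <|
          .pt 103 (.leaf [4, 2, 3]) <|
          .pt 125 (.leaf [4, 3, 1]) <|
          .jmp (.leaf [3, 2]) <|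
          .jmp (.leaf [2]) <|
          .nil) <|
      .jmp (.leaf [2]) <|
      .nil) <|
  .nil

/-- Answers for Betty to every move of Alfred from `P5_g8`. -/
def repliesG8 : Script :=
    .fam [25, 68, 92, 116] (.leaf [1, 6, 6, 6]) <|
    .pt 116 .cyc <|
    .pt 68 (.leaf [1, 6, 6]) <|
    .pt 92 (.leaf [1, 6, 6]) <|
    .jmp (.leaf [6, 6, 6]) <|
    .jmp (.leaf [6, 6]) <|
    .jmp (.place 91 <|
        .fam [68, 90, 92] (.leaf [0, 6, 6]) <|
        .pt 68 (.leaf [0, 6]) <|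
        .pt 92 (.leaf [0, 5, 7, 5]) <|
        .jmp (.leaf [6, 6]) <|
        .jmp (.leaf [6]) <|
        .nil) <|
    .jmp (.leaf [6]) <|
    .nil

/-- Positions with Betty to move along the drawing cycle through `P5`, each with a script
that starts with Betty's move on the cycle. -/
def cycle : List (ℕ × ℕ × Script) := [
  (25, 6602632166712011601641779586543207853369622528,
  .place 51 <|
    .fam [25, 42, 64] (.leaf [1, 7, 6]) <|
    .pt 64 .cyc <|
    .pt 42 (.leaf [1, 7, 5]) <|
    .jmp (.leaf [7, 6]) <|
    .jmp (.place 75 <|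
        .fam [42, 64, 86, 88] (.leaf [4, 7, 7, 6]) <|
        .fam [42, 62, 64, 88] (.leaf [5, 0, 7, 6]) <|
        .pt 42 (.leaf [4, 7, 7, 5]) <|
        .pt 64 (.leaf [4, 7, 6]) <|
        .jmp (.leaf [7, 7, 6]) <|
        .jmp (.leaf [0, 7, 6]) <|
        .jmp (.leaf [7, 6]) <|
        .jmp (.place 50 <|
            .fam [16, 38, 62] (.leaf [6, 7]) <|
            .pt 16 (.leaf [6, 7]) <|
            .pt 38 (.leaf [6, 7]) <|
            .jmp (.leaf [7]) <|
            .nil) <|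
        .jmp (.leaf [6]) <|
        .nil) <|
    .jmp (.place 50 <|
        .fam [16, 38, 62] (.leaf [6, 7]) <|
        .pt 16 (.leaf [6, 7]) <|
        .pt 38 (.leaf [6, 7]) <|
        .jmp (.leaf [7]) <|
        .nil) <|
    .jmp (.leaf [6]) <|
    .jmp (.place 75 <|
        .fam [42, 64, 86] (.leaf [7, 7, 6]) <|
        .pt 42 (.leaf [7, 7, 5]) <|
        .pt 64 (.leaf [7, 6]) <|
        .jmp (.leaf [7, 6]) <|
        .jmp (.place 50 <|
            .fam [16, 38, 62] (.leaf [6, 7]) <|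
            .pt 16 (.leaf [6, 7]) <|
            .pt 38 (.leaf [6, 7]) <|
            .jmp (.leaf [7]) <|
            .nil) <|
        .jmp (.leaf [6]) <|
        .nil) <|
    .nil),
  (25, 6602632166712011601641779604992203726892859392,
  .place 77 <|
    .fam [25, 68, 90, 92] (.leaf [1, 0, 6, 6]) <|
    .pt 90 .cyc <|
    .pt 68 (.leaf [1, 0, 6]) <|
    .pt 92 (.leaf [1, 0, 5, 7, 5]) <|
    .jmp (.leaf [0, 6, 6]) <|
    .jmp (.leaf [6, 6]) <|
    .jmp (.place 104 <|
        .fam [68, 92, 116] (.leaf [6, 6, 6]) <|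
        .pt 68 (.leaf [6, 6]) <|
        .pt 92 (.leaf [6, 6]) <|
        .jmp (.leaf [6, 6]) <|
        .jmp (.leaf [6]) <|
        .nil) <|
    .jmp (.leaf [6]) <|
    .nil),
  (25, bitsP5, .place 103 repliesG8),
  (25, 6602632166795098493821229827896735745331986432,
  .place 129 <|
    .fam [13, 16, 25, 26, 28, 37, 49, 142] (.place 142 <|
        .fam [13, 25, 26, 37] (.place 13 <|
            .fam [25] (.leaf [6]) <|
            .nil) <|
        .pt 13 (.leaf [6]) <|
        .pt 14 (.leaf [7]) <|
        .pt 26 (.leaf [0, 5]) <|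
        .pt 37 (.leaf [2, 7]) <|
        .nil) <|
    .fam [14, 16, 17, 19, 25, 26, 28, 29, 31, 37, 39, 41, 42, 43, 45, 50, 52, 54, 55, 57, 62, 65,
        67, 68, 69, 74, 75, 78, 79, 81, 86, 88, 89, 92, 93, 98, 99, 100, 101, 102, 105, 115, 117,
        127, 128, 130, 141, 153, 154] (.place 14 <|
        .fam [25] (.leaf [7]) <|
        .jmp (.place 129 <|
            .fam [68, 92, 116, 142] (.leaf [5, 6, 6, 6]) <|
            .pt 68 (.leaf [5, 6, 6]) <|
            .pt 92 (.leaf [5, 6, 6]) <|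
            .pt 116 (.place 103 <|
                .fam [68, 90, 92, 142] (.leaf [5, 0, 6, 6]) <|
                .pt 68 (.leaf [5, 0, 6]) <|
                .pt 90 (.place 77 <|
                    .fam [42, 64, 142] (.leaf [5, 7, 6]) <|
                    .pt 42 (.leaf [5, 7, 5]) <|
                    .pt 64 (.place 51 <|
                        .fam [16, 38, 142] (.leaf [5, 7]) <|
                        .pt 16 (.leaf [5, 7]) <|
                        .pt 38 (.leaf [5, 7]) <|
                        .jmp (.leaf [7]) <|
                        .nil) <|
                    .jmp (.leaf [7, 6]) <|
                    .jmp (.place 75 <|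
                        .fam [42, 64, 86, 88] (.leaf [4, 7, 7, 6]) <|
                        .fam [42, 62, 64, 88] (.leaf [5, 0, 7, 6]) <|
                        .pt 42 (.leaf [4, 7, 7, 5]) <|
                        .pt 64 (.leaf [4, 7, 6]) <|
                        .jmp (.leaf [7, 7, 6]) <|
                        .jmp (.leaf [0, 7, 6]) <|
                        .jmp (.leaf [7, 6]) <|
                        .jmp (.place 50 <|
                            .fam [16, 38, 62] (.leaf [6, 7]) <|
                            .pt 16 (.leaf [6, 7]) <|
                            .pt 38 (.leaf [6, 6]) <|
                            .jmp (.leaf [7]) <|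
                            .nil) <|
                        .jmp (.leaf [6]) <|
                        .nil) <|
                    .jmp (.place 50 <|
                        .fam [16, 38, 62] (.leaf [6, 7]) <|
                        .pt 16 (.leaf [6, 7]) <|
                        .pt 38 (.leaf [6, 6]) <|
                        .jmp (.leaf [7]) <|
                        .nil) <|
                    .jmp (.leaf [6]) <|
                    .jmp (.place 74 <|
                        .fam [42, 62, 64, 86] (.leaf [6, 0, 7, 6]) <|
                        .pt 42 (.leaf [6, 0, 7, 5]) <|
                        .pt 62 (.place 50 <|
                            .fam [16, 38, 86] (.leaf [6, 7]) <|
                            .pt 16 (.leaf [6, 7]) <|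
                            .pt 38 (.leaf [6, 6]) <|
                            .jmp (.leaf [7]) <|
                            .nil) <|
                        .pt 64 (.leaf [6, 0, 6, 7]) <|
                        .jmp (.leaf [0, 7, 6]) <|
                        .jmp (.leaf [7, 6]) <|
                        .jmp (.leaf [6]) <|
                        .nil) <|
                    .nil) <|
                .pt 92 (.leaf [5, 0, 5, 7, 5]) <|
                .jmp (.leaf [0, 6, 6]) <|
                .jmp (.leaf [6, 6]) <|
                .jmp (.place 104 <|
                    .fam [68, 92, 116] (.leaf [6, 6, 6]) <|
                    .pt 68 (.leaf [6, 6]) <|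
                    .pt 92 (.leaf [6, 6]) <|
                    .jmp (.leaf [6, 6]) <|
                    .jmp (.leaf [6]) <|
                    .nil) <|
                .jmp (.leaf [6]) <|
                .nil) <|
            .jmp (.leaf [6, 6, 6]) <|
            .jmp (.leaf [6, 6]) <|
            .jmp (.place 91 <|
                .fam [68, 90, 92] (.leaf [0, 6, 6]) <|
                .pt 68 (.leaf [0, 6]) <|
                .pt 92 (.leaf [0, 5, 7, 5]) <|
                .jmp (.leaf [6, 6]) <|
                .jmp (.leaf [6]) <|
                .nil) <|
            .jmp (.leaf [6]) <|
            .nil) <|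
        .nil) <|
    .pt 13 (.leaf [6]) <|
    .pt 14 (.leaf [7]) <|
    .pt 16 (.place 142 <|
        .fam [13, 25, 26, 37] (.place 13 <|
            .fam [25] (.leaf [6]) <|
            .nil) <|
        .pt 13 (.leaf [6]) <|
        .pt 14 (.leaf [7]) <|
        .pt 26 (.leaf [0, 5]) <|
        .pt 37 (.leaf [2, 7]) <|
        .nil) <|
    .pt 26 (.leaf [0, 5]) <|
    .pt 28 (.place 142 <|
        .fam [13, 25, 26, 37] (.place 13 <|
            .fam [25] (.leaf [6]) <|
            .nil) <|
        .pt 13 (.leaf [6]) <|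
        .pt 14 (.leaf [7]) <|
        .pt 26 (.leaf [0, 7]) <|
        .pt 37 (.leaf [2, 7]) <|
        .nil) <|
    .pt 37 (.leaf [2, 7]) <|
    .jmp .cyc <|
    .nil),
  (142, 6602632166712011601641779586543207578491715584,
  .place 129 <|
    .fam [68, 92, 116, 142] (.leaf [5, 6, 6, 6]) <|
    .pt 116 .cyc <|
    .pt 68 (.leaf [5, 6, 6]) <|
    .pt 92 (.leaf [5, 6, 6]) <|
    .jmp (.leaf [6, 6, 6]) <|
    .jmp (.leaf [6, 6]) <|
    .jmp (.place 91 <|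
        .fam [68, 90, 92] (.leaf [0, 6, 6]) <|
        .pt 68 (.leaf [0, 6]) <|
        .pt 92 (.leaf [0, 5, 7, 5]) <|
        .jmp (.leaf [6, 6]) <|
        .jmp (.leaf [6]) <|
        .nil) <|
    .jmp (.leaf [6]) <|
    .nil),
  (142, 6602632847359822193255263755348910383295660032,
  .place 103 <|
    .fam [68, 90, 92, 142] (.leaf [5, 0, 6, 6]) <|
    .pt 90 .cyc <|
    .pt 68 (.leaf [5, 0, 6]) <|
    .pt 92 (.leaf [5, 0, 5, 7, 5]) <|
    .jmp (.leaf [0, 6, 6]) <|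
    .jmp (.leaf [6, 6]) <|
    .jmp (.place 104 <|
        .fam [68, 92, 116] (.leaf [6, 6, 6]) <|
        .pt 68 (.leaf [6, 6]) <|
        .pt 92 (.leaf [6, 6]) <|
        .jmp (.leaf [6, 6]) <|
        .jmp (.leaf [6]) <|
        .nil) <|
    .jmp (.leaf [6]) <|
    .nil),
  (142, 6602632847359832335698005620469502631820427264,
  .place 77 <|
    .fam [42, 64, 142] (.leaf [5, 7, 6]) <|
    .pt 64 .cyc <|
    .pt 42 (.leaf [5, 7, 5]) <|
    .jmp (.leaf [7, 6]) <|
    .jmp (.place 75 <|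
        .fam [42, 64, 86, 88] (.leaf [4, 7, 7, 6]) <|
        .fam [42, 62, 64, 88] (.leaf [5, 0, 7, 6]) <|
        .pt 42 (.leaf [4, 7, 7, 5]) <|
        .pt 64 (.leaf [4, 7, 6]) <|
        .jmp (.leaf [7, 7, 6]) <|
        .jmp (.leaf [0, 7, 6]) <|
        .jmp (.leaf [7, 6]) <|
        .jmp (.place 50 <|
            .fam [16, 38, 62] (.leaf [6, 7]) <|
            .pt 16 (.leaf [6, 7]) <|
            .pt 38 (.leaf [6, 7]) <|
            .jmp (.leaf [7]) <|
            .nil) <|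
        .jmp (.leaf [6]) <|
        .nil) <|
    .jmp (.place 50 <|
        .fam [16, 38, 62] (.leaf [6, 7]) <|
        .pt 16 (.leaf [6, 7]) <|
        .pt 38 (.leaf [6, 7]) <|
        .jmp (.leaf [7]) <|
        .nil) <|
    .jmp (.leaf [6]) <|
    .jmp (.place 75 <|
        .fam [42, 64, 86] (.leaf [7, 7, 6]) <|
        .pt 42 (.leaf [7, 7, 5]) <|
        .pt 64 (.leaf [7, 6]) <|
        .jmp (.leaf [7, 6]) <|
        .jmp (.place 50 <|
            .fam [16, 38, 62] (.leaf [6, 7]) <|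
            .pt 16 (.leaf [6, 7]) <|
            .pt 38 (.leaf [6, 7]) <|
            .jmp (.leaf [7]) <|
            .nil) <|
        .jmp (.leaf [6]) <|
        .nil) <|
    .nil),
  (142, 6602632847359832335698156754643698534176817152,
  .place 51 <|
    .fam [16, 38, 142] (.leaf [5, 7]) <|
    .pt 38 .cyc <|
    .pt 16 (.leaf [5, 7]) <|
    .jmp (.leaf [7]) <|
    .nil),
  (142, 6602632847359832335698156754645950608868409344,
  .move [5] <|
    .fam [13, 25, 26, 37, 38] (.place 13 <|
        .fam [25] (.leaf [6]) <|
        .nil) <|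
    .fam [13, 25, 26, 38, 49, 50, 61, 62] (.place 13 <|
        .fam [25] (.leaf [6]) <|
        .jmp (.place 37 <|
            .fam [25, 49] (.leaf [6, 6]) <|
            .pt 25 (.leaf [6]) <|
            .jmp (.leaf [6]) <|
            .nil) <|
        .nil) <|
    .pt 38 .cyc <|
    .pt 13 (.leaf [6]) <|
    .pt 14 (.leaf [7]) <|
    .pt 26 (.leaf [0, 5]) <|
    .nil)]

/-! ### The position `P5` -/

/-- A position on the cycle with Betty to move. -/
def OnCycle (s : PState) : Prop :=
  s.turn = false ∧ ∃ e ∈ cycle, s.ball = pt e.1 ∧ Known e.2.1 0 s.chaps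

/-- Keys of the positions on the cycle. -/
def cycleKeys : List (ℕ × ℕ) := cycle.map fun e => (e.1, e.2.1)

theorem valid_of_mem_cycle : ∀ e ∈ cycle, inside e.1 = true ∧ depth e.2.2 ≠ 0 ∧
    valid false cycleKeys e.2.2 .attack e.1 e.2.1 0 = true := by
  decide +kernel

theorem replies_repliesP5 :
    replies true (2 ^ 103) (cover repliesP5) (valid true [] repliesP5 .placed)
      (valid true [] repliesP5 .jumped) 25 bitsP5 0 = true := by
  decide +kernel

theorem replies_repliesG8 :
    replies false 0 (cover repliesG8) (valid false cycleKeys repliesG8 .placed)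
      (valid false cycleKeys repliesG8 .jumped) 25 (bitsP5 ||| 2 ^ 103) 0 = true := by
  decide +kernel

theorem known_P5 : Known bitsP5 0 P5.chaps := by
  have h1 : ∀ i < 168, bitsP5.testBit i = true → pt i ∈ P5.chaps := by decide +kernel
  have h2 : ∀ q ∈ P5.chaps, ((1 ≤ q.1 ∧ q.1 ≤ 10 ∧ 1 ≤ q.2 ∧ q.2 ≤ 12) ∧
      bitsP5.testBit (12 * q.2 + q.1).toNat = true) := by decide +kernel
  refine ⟨fun i hi => ?_, fun i hi => Or.inl ?_, fun q hq => (h2 q hq).1⟩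
  · refine h1 i ?_ hi
    by_contra! h
    rw [Nat.testBit_lt_two_pow (lt_of_lt_of_le (b := 2 ^ 168) (by decide)
      (Nat.pow_le_pow_right (by decide) h))] at hi
    cases hi
  · convert (h2 _ hi).2
    simp only [pt]
    omega

theorem onCycle_of_mem {b C : ℕ} {c : Finset (ℤ × ℤ)} (hm : (b, C) ∈ cycleKeys)
    (h : Known C 0 c) : OnCycle ⟨pt b, c, false⟩ := by
  obtain ⟨e, he, h'⟩ := List.mem_map.1 hm
  cases h'
  exact ⟨rfl, e, he, rfl, h⟩

/-- Betty can continue along the cycle. -/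
theorem OnCycle.continues {s : PState} (hs : OnCycle s) :
    winner 12 s = none ∧ s.turn = false ∧ ∃ t, MoveRel 12 10 s t ∧
      (winner 12 t = some false ∨ ∃ k, Forces 12 10 false OnCycle k t) := by
  obtain ⟨b, c, u⟩ := s
  obtain ⟨hu, e, he, hb, h⟩ := hs
  simp only at hu hb h
  subst hu hb
  obtain ⟨hb, hd, hv⟩ := valid_of_mem_cycle e he
  refine ⟨winner_of_inside hb _ _, rfl, ?_⟩
  rcases meaning_of_valid onCycle_of_mem _ _ hb h hv with ⟨hc, -⟩ | ⟨t, hm, ht⟩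
  · simp [hc, depth] at hd
  · exact ⟨t, hm, ht.imp_right fun ht => ⟨_, ht⟩⟩

theorem forces_P5_g8 : Forces 12 10 false OnCycle (depth repliesG8) P5_g8 := by
  have h : Known (bitsP5 ||| 2 ^ 103) 0 P5_g8.chaps :=
    known_P5.insert_left (i := 103) (onBoard_pt.2 (by decide))
  exact forces_of_replies replies_repliesG8 h
    (meaning_of_valid onCycle_of_mem _ _ (by decide) h) (meaning_of_valid onCycle_of_mem _ _)

/-- From `P5`, placing a chap at g8 is Betty's unique non-losing move:
it is a legal move; after it, Alfred has no winning strategy from the resulting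
position; and every other legal move of Betty from `P5` leads to a position
from which Alfred has a winning strategy. -/
theorem P5_unique_nonlosing :
    MoveRel 12 10 P5 P5_g8 ∧
    ¬ WinsFrom 12 10 true P5_g8 ∧
    ∀ t, MoveRel 12 10 P5 t → t ≠ P5_g8 → WinsFrom 12 10 true t := by
  refine ⟨⟨rfl, Or.inl ⟨(7, 8), by simp [OnBoard], by decide, by decide, rfl, rfl⟩⟩,
    Forces.not_winsFrom (fun _ => OnCycle.continues) forces_P5_g8, fun t ht hne => ?_⟩
  have hG : ∀ {b C : ℕ} {c : Finset (ℤ × ℤ)}, (b, C) ∈ ([] : List (ℕ × ℕ)) → Known C 0 c →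
      False := fun h _ => List.not_mem_nil h
  obtain ⟨-, -, h⟩ := of_replies (G := fun _ => False) replies_repliesP5 known_P5
    (meaning_of_valid hG _ _ (by decide) known_P5) (meaning_of_valid hG _ _)
  rcases h t ht with h | ⟨i, hi, rfl⟩
  · exact h.winsFrom
  · rw [Nat.testBit_two_pow, decide_eq_true_eq] at hi
    subst hi
    exact absurd rfl hne
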